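/- Consider a composite reflection A ⇄ B ⇄ C, where A is a semi-abelian category, B is a Birkhoff subcategory of A with reflector I : A → B, and C is a (normal epi)-reflective subcategory of B that is admissible with respect to normal epimorphisms and whose reflector J : B → C is protoadditive. Then the composite reflector J ∘ I : A → C is admissible with respect to normal epimorphisms, and for any normal epimorphism f : A → B in A the following conditions are equivalent: (1) f is a normal extension with respect to J ∘ I; (2) f is a central extension with respect to J ∘ I; (3) K[f] ∈ C and f is a normal extension with respect to I. -/

import Mathlib

open CategoryTheory CategoryTheory.Limits

universe v u v₂ u₂

namespace ProtoPaper

variable {C : Type u} [Category.{v} C]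

section ZeroDefs

variable [HasZeroMorphisms C]

/-- `k` is a kernel of `f`. -/
def IsKernelOf {K A B : C} (k : K ⟶ A) (f : A ⟶ B) : Prop :=
  ∃ w : k ≫ f = 0, Nonempty (IsLimit (KernelFork.ofι k w))

/-- `f` is a cokernel of `k`. -/
def IsCokernelOf {K A B : C} (f : A ⟶ B) (k : K ⟶ A) : Prop :=
  ∃ w : k ≫ f = 0, Nonempty (IsColimit (CokernelCofork.ofπ f w))

/-- A normal monomorphism: a kernel of some morphism. -/
def IsNormalMonoArrow {K A : C} (k : K ⟶ A) : Prop :=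
  ∃ (B : C) (f : A ⟶ B), IsKernelOf k f

/-- A normal epimorphism: a cokernel of some morphism. -/
def IsNormalEpiArrow {A B : C} (f : A ⟶ B) : Prop :=
  ∃ (K : C) (k : K ⟶ A), IsCokernelOf f k

/-- A split short exact sequence `0 → K → A ⇄ B → 0`. -/
structure IsSplitShortExact {K A B : C} (k : K ⟶ A) (f : A ⟶ B) (s : B ⟶ A) : Prop where
  isKernel : IsKernelOf k f
  split : s ≫ f = 𝟙 B

/-- A short exact sequence `0 → K → A → B → 0`. -/
structure IsShortExact {K A B : C} (k : K ⟶ A) (f : A ⟶ B) : Prop where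
  isKernel : IsKernelOf k f
  isCokernel : IsCokernelOf f k

/-- A protosplit monomorphism: a kernel of a split epimorphism. -/
def IsProtosplitMono {K A : C} (k : K ⟶ A) : Prop :=
  ∃ (B : C) (f : A ⟶ B) (s : B ⟶ A), IsSplitShortExact k f s

end ZeroDefs

/-- A pointed category is protomodular when the split short five lemma holds. -/
def IsProtomodular (C : Type u) [Category.{v} C] [HasZeroMorphisms C] : Prop :=
  ∀ ⦃K A B K' A' B' : C⦄ (k : K ⟶ A) (f : A ⟶ B) (s : B ⟶ A)
    (k' : K' ⟶ A') (f' : A' ⟶ B') (s' : B' ⟶ A')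
    (κ : K ⟶ K') (α : A ⟶ A') (β : B ⟶ B'),
    IsSplitShortExact k f s → IsSplitShortExact k' f' s' →
    k ≫ α = κ ≫ k' → f ≫ β = α ≫ f' → s ≫ α = β ≫ s' →
    IsIso κ → IsIso β → IsIso α

section Functors

variable {D : Type u₂} [Category.{v₂} D]

/-- A functor is protoadditive if it preserves split short exact sequences. -/
def IsProtoadditive [HasZeroMorphisms C] [HasZeroMorphisms D] (F : C ⥤ D) : Prop :=
  ∀ ⦃K A B : C⦄ (k : K ⟶ A) (f : A ⟶ B) (s : B ⟶ A),
    IsSplitShortExact k f s → IsSplitShortExact (F.map k) (F.map f) (F.map s)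

/-- A functor preserves zero objects. -/
def PreservesZeroObjects (F : C ⥤ D) : Prop :=
  ∀ X : C, IsZero X → IsZero (F.obj X)

/-- A functor preserves pullbacks along split epimorphisms. -/
def PreservesPullbacksAlongSplitEpis (F : C ⥤ D) : Prop :=
  ∀ ⦃P X Y Z : C⦄ (fst : P ⟶ X) (snd : P ⟶ Y) (f : X ⟶ Z) (g : Y ⟶ Z),
    IsSplitEpi f → IsPullback fst snd f g →
    IsPullback (F.map fst) (F.map snd) (F.map f) (F.map g)

end Functors

/-- A homological category: pointed, protomodular and regular (finitely complete with
pullback-stable (regular epi, mono) factorisations). -/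
structure IsHomological (C : Type u) [Category.{v} C] [HasZeroObject C]
    [HasZeroMorphisms C] : Prop where
  protomodular : IsProtomodular C
  hasFiniteLimits : HasFiniteLimits C
  regEpiMonoFac : ∀ ⦃X Y : C⦄ (f : X ⟶ Y),
    ∃ (I : C) (e : X ⟶ I) (m : I ⟶ Y), Nonempty (RegularEpi e) ∧ Mono m ∧ e ≫ m = f
  regEpiStable : ∀ ⦃P X Y Z : C⦄ (fst : P ⟶ X) (snd : P ⟶ Y) (f : X ⟶ Z) (g : Y ⟶ Z),
    IsPullback fst snd f g → Nonempty (RegularEpi f) → Nonempty (RegularEpi snd)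

/-- An internal equivalence relation, given by a jointly monic pair which is internally
reflexive, symmetric and transitive. -/
structure IsInternalEquivRel {R X : C} (p₁ p₂ : R ⟶ X) : Prop where
  jointlyMono : ∀ ⦃Z : C⦄ (a b : Z ⟶ R), a ≫ p₁ = b ≫ p₁ → a ≫ p₂ = b ≫ p₂ → a = b
  refl : ∃ d : X ⟶ R, d ≫ p₁ = 𝟙 X ∧ d ≫ p₂ = 𝟙 X
  symm : ∃ σ : R ⟶ R, σ ≫ p₁ = p₂ ∧ σ ≫ p₂ = p₁
  trans : ∀ ⦃P : C⦄ (q₁ q₂ : P ⟶ R), IsPullback q₁ q₂ p₂ p₁ →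
    ∃ t : P ⟶ R, t ≫ p₁ = q₁ ≫ p₁ ∧ t ≫ p₂ = q₂ ≫ p₂

/-- A semi-abelian category: homological, with binary coproducts, and exact
(every internal equivalence relation is a kernel pair). -/
structure IsSemiAbelian (C : Type u) [Category.{v} C] [HasZeroObject C]
    [HasZeroMorphisms C] : Prop where
  homological : IsHomological C
  hasBinaryCoproducts : HasBinaryCoproducts C
  equivRelEffective : ∀ ⦃R X : C⦄ (p₁ p₂ : R ⟶ X), IsInternalEquivRel p₁ p₂ →
    ∃ (Y : C) (f : X ⟶ Y), IsPullback p₁ p₂ f f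

/-- A full subcategory (given by a predicate on objects) is replete if it is closed
under isomorphisms. -/
def Replete (P : C → Prop) : Prop := ∀ ⦃X Y : C⦄, P X → (X ≅ Y) → P Y

/-- A reflection of `C` onto the full subcategory of objects satisfying `P`:
a reflector `F`, a unit `η`, landing in `P`, with the usual universal property. -/
structure Reflection (C : Type u) [Category.{v} C] (P : C → Prop) where
  F : C ⥤ C
  η : 𝟭 C ⟶ F
  mem : ∀ X : C, P (F.obj X)
  univ : ∀ ⦃X B : C⦄, P B → ∀ f : X ⟶ B, ∃! g : F.obj X ⟶ B, η.app X ≫ g = f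

variable {P : C → Prop}

/-- A (normal epi)-reflection: all units are normal epimorphisms. -/
def NormalEpiUnits [HasZeroMorphisms C] (R : Reflection C P) : Prop :=
  ∀ X : C, IsNormalEpiArrow (R.η.app X)

/-- `f` is a trivial extension with respect to the reflection `R`. -/
def IsTrivialExt (R : Reflection C P) {A B : C} (f : A ⟶ B) : Prop :=
  IsPullback (R.η.app A) f (R.F.map f) (R.η.app B)

/-- `p` is an effective descent morphism: the pullback functor between the slice
categories is monadic. -/
def IsEffectiveDescent [HasPullbacks C] {E B : C} (p : E ⟶ B) : Prop :=
  Nonempty (MonadicRightAdjoint (Over.pullback p))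

/-- A central extension with respect to the (absolute) Galois structure of a reflection:
some pullback along an effective descent morphism is a trivial extension. -/
def IsCentralExt [HasPullbacks C] (R : Reflection C P) {A B : C} (f : A ⟶ B) : Prop :=
  ∃ (E : C) (p : E ⟶ B), IsEffectiveDescent p ∧
    ∃ (Pb : C) (p1 : Pb ⟶ E) (p2 : Pb ⟶ A), IsPullback p1 p2 p f ∧ IsTrivialExt R p1

/-- A normal extension with respect to the (absolute) Galois structure of a reflection. -/
def IsNormalExt [HasPullbacks C] (R : Reflection C P) {A B : C} (f : A ⟶ B) : Prop :=
  IsEffectiveDescent f ∧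
    ∃ (Pb : C) (p1 p2 : Pb ⟶ A), IsPullback p1 p2 f f ∧ IsTrivialExt R p1

/-- A central extension with respect to the Galois structure of a reflection relative to
the class of normal epimorphisms. -/
def IsCentralExtN [HasZeroMorphisms C] (R : Reflection C P) {A B : C} (f : A ⟶ B) : Prop :=
  IsNormalEpiArrow f ∧ ∃ (E : C) (p : E ⟶ B), IsNormalEpiArrow p ∧
    ∃ (Pb : C) (p1 : Pb ⟶ E) (p2 : Pb ⟶ A), IsPullback p1 p2 p f ∧ IsTrivialExt R p1

/-- A normal extension with respect to the Galois structure of a reflection relative to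
the class of normal epimorphisms. -/
def IsNormalExtN [HasZeroMorphisms C] (R : Reflection C P) {A B : C} (f : A ⟶ B) : Prop :=
  IsNormalEpiArrow f ∧
    ∃ (Pb : C) (p1 p2 : Pb ⟶ A), IsPullback p1 p2 f f ∧ IsTrivialExt R p1

/-- The reflector is semi-left-exact: it preserves pullbacks of units along morphisms
with domain in the subcategory. -/
def SemiLeftExact (R : Reflection C P) : Prop :=
  ∀ ⦃A X Pb : C⦄ (x : X ⟶ R.F.obj A) (p1 : Pb ⟶ A) (p2 : Pb ⟶ X), P X →
    IsPullback p1 p2 (R.η.app A) x →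
    IsPullback (R.F.map p1) (R.F.map p2) (R.F.map (R.η.app A)) (R.F.map x)

/-- The reflector has stable units: it preserves pullbacks of units along arbitrary
morphisms. -/
def StableUnits (R : Reflection C P) : Prop :=
  ∀ ⦃A X Pb : C⦄ (x : X ⟶ R.F.obj A) (p1 : Pb ⟶ A) (p2 : Pb ⟶ X),
    IsPullback p1 p2 (R.η.app A) x →
    IsPullback (R.F.map p1) (R.F.map p2) (R.F.map (R.η.app A)) (R.F.map x)

/-- The reflection is admissible with respect to the class of normal epimorphisms:
the reflector preserves pullbacks of units along normal epimorphisms with domain in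
the subcategory. -/
def AdmissibleN [HasZeroMorphisms C] (R : Reflection C P) : Prop :=
  ∀ ⦃A X Pb : C⦄ (x : X ⟶ R.F.obj A) (p1 : Pb ⟶ A) (p2 : Pb ⟶ X), P X →
    IsNormalEpiArrow x →
    IsPullback p1 p2 (R.η.app A) x →
    IsPullback (R.F.map p1) (R.F.map p2) (R.F.map (R.η.app A)) (R.F.map x)

/-- The radical associated to a (normal epi)-reflection is idempotent. -/
def IdempotentRadical [HasZeroMorphisms C] (R : Reflection C P) : Prop :=
  ∀ ⦃A TA : C⦄ (t : TA ⟶ A), IsKernelOf t (R.η.app A) →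
    ∀ ⦃T2 : C⦄ (t2 : T2 ⟶ TA), IsKernelOf t2 (R.η.app TA) → IsIso t2

/-- Condition (N) for a (normal epi)-reflection: for any morphism `f` with kernel
`k : K ⟶ A`, and any kernel `t : TK ⟶ K` of the unit at `K`, the composite `t ≫ k`
is a normal monomorphism. -/
def ConditionN [HasZeroMorphisms C] (R : Reflection C P) : Prop :=
  ∀ ⦃A B : C⦄ (f : A ⟶ B) ⦃K : C⦄ (k : K ⟶ A), IsKernelOf k f →
    ∀ ⦃TK : C⦄ (t : TK ⟶ K), IsKernelOf t (R.η.app K) → IsNormalMonoArrow (t ≫ k)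

/-- A torsion theory on a pointed category, given by a pair of full replete
subcategories. -/
structure TorsionTheory (C : Type u) [Category.{v} C] [HasZeroMorphisms C]
    (T F : C → Prop) : Prop where
  repleteT : Replete T
  repleteF : Replete F
  hom_zero : ∀ ⦃X Y : C⦄ (f : X ⟶ Y), T X → F Y → f = 0
  exists_ses : ∀ A : C, ∃ (TA FA : C) (t : TA ⟶ A) (q : A ⟶ FA),
    T TA ∧ F FA ∧ IsShortExact t q

/-- Condition (N) for a torsion theory, formulated without reference to a chosen
reflector: for any morphism `f` with kernel `k : K ⟶ A` and any short exact sequence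
`0 → TK → K → FK → 0` with `TK` torsion and `FK` torsion-free, the composite
`TK → A` is a normal monomorphism. -/
def TTConditionN [HasZeroMorphisms C] (T F : C → Prop) : Prop :=
  ∀ ⦃A B K TK FK : C⦄ (f : A ⟶ B) (k : K ⟶ A) (t : TK ⟶ K) (q : K ⟶ FK),
    IsKernelOf k f → T TK → F FK → IsShortExact t q → IsNormalMonoArrow (t ≫ k)

/-- Condition (P) for a torsion theory: the torsion-free reflector is protoadditive
(formulated for every (normal epi)-reflection onto the torsion-free part). -/
def TTConditionP [HasZeroMorphisms C] (T F : C → Prop) : Prop :=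
  ∀ R : Reflection C F, NormalEpiUnits R → IsProtoadditive R.F

/-- Orthogonality `e ↓ m` of two morphisms. -/
def Orthogonal {A B X Y : C} (e : A ⟶ B) (m : X ⟶ Y) : Prop :=
  ∀ (a : A ⟶ X) (b : B ⟶ Y), e ≫ b = a ≫ m →
    ∃! d : B ⟶ X, e ≫ d = a ∧ d ≫ m = b

/-- The class of morphisms orthogonal on the right to all members of `E`. -/
def dnOrth (E : MorphismProperty C) : MorphismProperty C :=
  fun _ _ m => ∀ ⦃A B : C⦄ (e : A ⟶ B), E e → Orthogonal e m

/-- The class of morphisms orthogonal on the left to all members of `M`. -/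
def upOrth (M : MorphismProperty C) : MorphismProperty C :=
  fun _ _ e => ∀ ⦃X Y : C⦄ (m : X ⟶ Y), M m → Orthogonal e m

/-- A prefactorisation system. -/
structure IsPrefactorisationSystem (E M : MorphismProperty C) : Prop where
  E_eq : E = upOrth M
  M_eq : M = dnOrth E

/-- A factorisation system. -/
structure IsFactorisationSystem (E M : MorphismProperty C) : Prop where
  E_eq : E = upOrth M
  M_eq : M = dnOrth E
  fac : ∀ ⦃X Y : C⦄ (f : X ⟶ Y),
    ∃ (I : C) (e : X ⟶ I) (m : I ⟶ Y), E e ∧ M m ∧ e ≫ m = f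

/-- A pullback-stable class of morphisms. -/
def PullbackStable (E : MorphismProperty C) : Prop :=
  ∀ ⦃P X Y Z : C⦄ (fst : P ⟶ X) (snd : P ⟶ Y) (f : X ⟶ Z) (g : Y ⟶ Z),
    IsPullback fst snd f g → E f → E snd

/-- The class of morphisms inverted by the reflector. -/
def invertedByR (R : Reflection C P) : MorphismProperty C :=
  fun _ _ f => IsIso (R.F.map f)

/-- The class of morphisms all of whose pullbacks lie in `E` ("stably in `E`"). -/
def StablyIn (E : MorphismProperty C) : MorphismProperty C :=
  fun _ Y e => ∀ ⦃Pb W : C⦄ (fst : Pb ⟶ W) (snd : Pb ⟶ _) (g : W ⟶ Y),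
    IsPullback fst snd g e → E fst

/-- The class of morphisms locally in `M`: some pullback along an effective descent
morphism lies in `M`. -/
def locallyIn [HasPullbacks C] (M : MorphismProperty C) : MorphismProperty C :=
  fun _ B f => ∃ (E : C) (p : E ⟶ B), IsEffectiveDescent p ∧
    ∃ (Pb : C) (p1 : Pb ⟶ E) (p2 : Pb ⟶ _), IsPullback p1 p2 p f ∧ M p1

/-- The class `Ē` associated to a torsion theory: normal epimorphisms with torsion
kernel. -/
def Ebar [HasZeroMorphisms C] (T : C → Prop) : MorphismProperty C :=
  fun X _ e => IsNormalEpiArrow e ∧ ∃ (K : C) (k : K ⟶ X), IsKernelOf k e ∧ T K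

/-- The class `M̄` associated to a torsion theory: morphisms with torsion-free
kernel. -/
def Mbar [HasZeroMorphisms C] (F : C → Prop) : MorphismProperty C :=
  fun X _ m => ∃ (K : C) (k : K ⟶ X), IsKernelOf k m ∧ F K

/-- A Birkhoff subcategory: a (regular epi)-reflective subcategory such that the
naturality squares of the unit at regular epimorphisms are pushouts. -/
structure IsBirkhoff [HasZeroMorphisms C] (R : Reflection C P) : Prop where
  units_regEpi : ∀ X : C, Nonempty (RegularEpi (R.η.app X))
  pushout_units : ∀ ⦃A B : C⦄ (f : A ⟶ B), Nonempty (RegularEpi f) →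
    IsPushout f (R.η.app A) (R.η.app B) (R.F.map f)

section ArrowInstances

variable [HasZeroMorphisms C]

instance instZeroArrowHom (f g : Arrow C) : Zero (f ⟶ g) :=
  ⟨{ left := 0, right := 0, w := by simp }⟩

@[simp] lemma arrowHomZero_left (f g : Arrow C) : (0 : f ⟶ g).left = 0 := rfl

@[simp] lemma arrowHomZero_right (f g : Arrow C) : (0 : f ⟶ g).right = 0 := rfl

instance instArrowHasZeroMorphisms : HasZeroMorphisms (Arrow C) where
  comp_zero {X Y} f Z := by
    apply CommaMorphism.ext <;> simp
  zero_comp X {Y Z} f := by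
    apply CommaMorphism.ext <;> simp

end ArrowInstances

set_option linter.style.haveILetI false
set_option linter.unusedSectionVars false

section Helpers

open scoped ZeroObject

attribute [simp] pullback.lift_fst pullback.lift_snd prod.lift_fst prod.lift_snd
attribute [simp] pullback.lift_fst_assoc pullback.lift_snd_assoc

lemma isPullback_mk {C : Type u} [Category.{v} C] {P X Y Z : C} {fst : P ⟶ X} {snd : P ⟶ Y}
    {f : X ⟶ Z} {g : Y ⟶ Z} (w : fst ≫ f = snd ≫ g)
    (hex : ∀ ⦃W : C⦄ (a : W ⟶ X) (b : W ⟶ Y), a ≫ f = b ≫ g →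
      ∃ l : W ⟶ P, l ≫ fst = a ∧ l ≫ snd = b)
    (hm : ∀ ⦃W : C⦄ (a b : W ⟶ P), a ≫ fst = b ≫ fst → a ≫ snd = b ≫ snd → a = b) :
    IsPullback fst snd f g := by
  refine ⟨⟨w⟩, ⟨PullbackCone.IsLimit.mk w
    (fun s => (hex s.fst s.snd s.condition).choose)
    (fun s => (hex s.fst s.snd s.condition).choose_spec.1)
    (fun s => (hex s.fst s.snd s.condition).choose_spec.2) ?_⟩⟩
  intro s m h1 h2
  apply hm
  · rw [h1, (hex s.fst s.snd s.condition).choose_spec.1]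
  · rw [h2, (hex s.fst s.snd s.condition).choose_spec.2]

variable {C : Type u} [Category.{v} C] [HasZeroMorphisms C]

lemma isKernelOf_mk {K A B : C} {k : K ⟶ A} {f : A ⟶ B} (w : k ≫ f = 0)
    (hm : ∀ ⦃W : C⦄ (a b : W ⟶ K), a ≫ k = b ≫ k → a = b)
    (hex : ∀ ⦃W : C⦄ (a : W ⟶ A), a ≫ f = 0 → ∃ l : W ⟶ K, l ≫ k = a) :
    IsKernelOf k f := by
  refine ⟨w, ⟨KernelFork.IsLimit.ofι k w (fun a h => (hex a h).choose)
    (fun a h => (hex a h).choose_spec) ?_⟩⟩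
  intro W a h m hm'
  apply hm
  rw [hm', (hex a h).choose_spec]

lemma IsKernelOf.w {K A B : C} {k : K ⟶ A} {f : A ⟶ B} (h : IsKernelOf k f) : k ≫ f = 0 := h.1

lemma IsKernelOf.exists_lift {K A B : C} {k : K ⟶ A} {f : A ⟶ B} (h : IsKernelOf k f)
    {W : C} (a : W ⟶ A) (ha : a ≫ f = 0) : ∃ l : W ⟶ K, l ≫ k = a := by
  obtain ⟨w, ⟨hl⟩⟩ := h
  exact ⟨hl.lift (KernelFork.ofι a ha), hl.fac (KernelFork.ofι a ha) WalkingParallelPair.zero⟩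

lemma IsKernelOf.hom_ext {K A B : C} {k : K ⟶ A} {f : A ⟶ B} (h : IsKernelOf k f)
    {W : C} (a b : W ⟶ K) (hab : a ≫ k = b ≫ k) : a = b := by
  obtain ⟨w, ⟨hl⟩⟩ := h
  exact Fork.IsLimit.hom_ext hl hab

lemma isKernelOf_kernel [HasKernels C] {A B : C} (f : A ⟶ B) : IsKernelOf (kernel.ι f) f :=
  isKernelOf_mk (kernel.condition f) (fun _ a b h => (cancel_mono (kernel.ι f)).1 h)
    (fun _ a h => ⟨kernel.lift f a h, by simp⟩)

lemma IsNormalEpiArrow.regEpi {A B : C} {f : A ⟶ B} (h : IsNormalEpiArrow f) :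
    Nonempty (RegularEpi f) := by
  obtain ⟨K, k, w, ⟨hc⟩⟩ := h
  exact ⟨{ W := K, left := k, right := 0, w := by simp [w], isColimit := hc }⟩

lemma IsNormalEpiArrow.comp_iso {A B B' : C} {f : A ⟶ B} (h : IsNormalEpiArrow f)
    (i : B ⟶ B') [IsIso i] : IsNormalEpiArrow (f ≫ i) := by
  obtain ⟨K, k, w, ⟨hc⟩⟩ := h
  have w' : k ≫ f ≫ i = 0 := by rw [← Category.assoc, w, zero_comp]
  refine ⟨K, k, w', ⟨CokernelCofork.IsColimit.ofπ _ _
    (fun g hg => inv i ≫ hc.desc (CokernelCofork.ofπ g hg)) ?_ ?_⟩⟩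
  · intro Z g hg
    have := hc.fac (CokernelCofork.ofπ g hg) WalkingParallelPair.one
    simpa using this
  · intro Z g hg m hm
    rw [IsIso.eq_inv_comp]
    apply Cofork.IsColimit.hom_ext hc
    have := hc.fac (CokernelCofork.ofπ g hg) WalkingParallelPair.one
    simp at this hm ⊢
    rw [hm]
    exact this.symm

lemma strongEpi_of_regEpi {A B : C} {f : A ⟶ B} (h : Nonempty (RegularEpi f)) : StrongEpi f := by
  haveI : IsRegularEpi f := ⟨h⟩
  infer_instance

variable [HasZeroObject C]

lemma regEpi_of_strongEpi (hH : IsHomological C) {A B : C} (f : A ⟶ B) [StrongEpi f] :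
    Nonempty (RegularEpi f) := by
  obtain ⟨I, e, m, he, hm, rfl⟩ := hH.regEpiMonoFac f
  haveI : StrongEpi m := strongEpi_of_strongEpi e m
  haveI := isIso_of_mono_of_strongEpi m
  obtain ⟨he⟩ := he
  let i : Arrow.mk e ≅ Arrow.mk (e ≫ m) :=
    Arrow.isoMk (f := Arrow.mk e) (g := Arrow.mk (e ≫ m)) (Iso.refl _) (asIso m) (by simp)
  exact ⟨RegularEpi.ofArrowIso i he⟩

lemma strongEpi_pb (hH : IsHomological C) {P X Y Z : C} {fst : P ⟶ X} {snd : P ⟶ Y}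
    {f : X ⟶ Z} {g : Y ⟶ Z} (h : IsPullback fst snd f g) [StrongEpi f] : StrongEpi snd :=
  strongEpi_of_regEpi (hH.regEpiStable fst snd f g h (regEpi_of_strongEpi hH f))

/-- local lifting along a strong epi -/
lemma exists_local (hH : IsHomological C) {X Y Z : C} (f : X ⟶ Y) [StrongEpi f] (z : Z ⟶ Y) :
    ∃ (Z' : C) (e : Z' ⟶ Z) (x : Z' ⟶ X), StrongEpi e ∧ x ≫ f = e ≫ z := by
  haveI := hH.hasFiniteLimits
  exact ⟨pullback f z, pullback.snd f z, pullback.fst f z,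
    strongEpi_pb hH (IsPullback.of_hasPullback f z), pullback.condition⟩

lemma exists_desc (hH : IsHomological C) {X Y Z : C} (e : X ⟶ Y) [StrongEpi e] (h : X ⟶ Z)
    (hh : ∀ ⦃W : C⦄ (a b : W ⟶ X), a ≫ e = b ≫ e → a ≫ h = b ≫ h) :
    ∃ u : Y ⟶ Z, e ≫ u = h := by
  obtain ⟨r⟩ := regEpi_of_strongEpi hH e
  exact ⟨(RegularEpi.desc' r h (hh _ _ r.w)).1, (RegularEpi.desc' r h (hh _ _ r.w)).2⟩

lemma isIso_of_contains (hP : IsProtomodular C) {K A B M : C} {k : K ⟶ A} {f : A ⟶ B} {s : B ⟶ A}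
    (h : IsSplitShortExact k f s) (m : M ⟶ A) [Mono m] (k' : K ⟶ M) (s' : B ⟶ M)
    (hk : k' ≫ m = k) (hs : s' ≫ m = s) : IsIso m := by
  refine hP k' (m ≫ f) s' k f s (𝟙 K) m (𝟙 B) ⟨?_, ?_⟩ h (by simp [hk]) (by simp) (by simp [hs])
    inferInstance inferInstance
  · apply isKernelOf_mk
    · rw [← Category.assoc, hk, h.isKernel.w]
    · intro W a b hab
      apply h.isKernel.hom_ext
      rw [← hk, ← Category.assoc, hab, Category.assoc]
    · intro W a ha
      obtain ⟨l, hl⟩ := h.isKernel.exists_lift (a ≫ m) (by simpa using ha)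
      refine ⟨l, ?_⟩
      rw [← cancel_mono m, Category.assoc, hk, hl]
  · rw [← Category.assoc, hs, h.split]

lemma mono_of_trivial_kernel (hH : IsHomological C) {A B : C} (f : A ⟶ B)
    (h : ∀ ⦃Z : C⦄ (z : Z ⟶ A), z ≫ f = 0 → z = 0) : Mono f := by
  haveI := hH.hasFiniteLimits
  let d : A ⟶ pullback f f := pullback.lift (𝟙 A) (𝟙 A) rfl
  have hd1 : d ≫ pullback.fst f f = 𝟙 A := pullback.lift_fst _ _ _
  have hd2 : d ≫ pullback.snd f f = 𝟙 A := pullback.lift_snd _ _ _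
  have hs : IsSplitShortExact (0 : (0 : C) ⟶ pullback f f) (pullback.fst f f) d := by
    refine ⟨isKernelOf_mk (by simp) (fun W a b _ => (isZero_zero C).eq_of_tgt a b) ?_, hd1⟩
    intro W a ha
    refine ⟨0, ?_⟩
    have h2 : a ≫ pullback.snd f f = 0 := by
      apply h
      rw [Category.assoc, ← pullback.condition, ← Category.assoc, ha, zero_comp]
    apply pullback.hom_ext
    · simp [ha]
    · simp [h2]
  haveI : Mono d := ⟨fun a b hab => by
    have := congrArg (fun t => t ≫ pullback.fst f f) hab
    simpa [hd1] using this⟩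
  haveI : IsIso d := isIso_of_contains hH.protomodular hs d 0 (𝟙 A) (by simp) (by simp)
  have h12 : pullback.fst f f = pullback.snd f f := by
    rw [← cancel_epi d, hd1, hd2]
  refine ⟨fun {Z} a b hab => ?_⟩
  have h1 := pullback.lift_fst a b hab
  have h2 := pullback.lift_snd a b hab
  rw [← h1, h12, h2]

/-- kernel pairs permute -/
lemma perm (hH : IsHomological C) {A B B' : C} (f : A ⟶ B) (g : A ⟶ B') {Z : C} (x y z : Z ⟶ A)
    (h1 : x ≫ f = y ≫ f) (h2 : y ≫ g = z ≫ g) :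
    ∃ (Z' : C) (e : Z' ⟶ Z) (w : Z' ⟶ A), StrongEpi e ∧ w ≫ g = e ≫ x ≫ g ∧
      w ≫ f = e ≫ z ≫ f := by
  haveI := hH.hasFiniteLimits
  let T := pullback (pullback.snd f f) (pullback.fst g g)
  let tf : T ⟶ pullback f f := pullback.fst _ _
  let tg : T ⟶ pullback g g := pullback.snd _ _
  let X : T ⟶ A := tf ≫ pullback.fst f f
  let Y : T ⟶ A := tf ≫ pullback.snd f f
  let Y' : T ⟶ A := tg ≫ pullback.fst g g
  let Zc : T ⟶ A := tg ≫ pullback.snd g g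
  have hYY : Y = Y' := pullback.condition
  have hXY : X ≫ f = Y ≫ f := by simp only [X, Y, Category.assoc, pullback.condition]
  have hYZ : Y' ≫ g = Zc ≫ g := by simp only [Zc, Y', Category.assoc, pullback.condition]
  have extT : ∀ {W : C} (a b : W ⟶ T), a ≫ X = b ≫ X → a ≫ Y = b ≫ Y → a ≫ Zc = b ≫ Zc →
      a = b := by
    intro W a b hx hy hz
    have hy' := hy
    rw [hYY] at hy'
    apply pullback.hom_ext
    · apply pullback.hom_ext
      · simpa [X] using hx
      · simpa [Y] using hy
    · apply pullback.hom_ext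
      · simpa [Y'] using hy'
      · simpa [Zc] using hz
  have liftT : ∀ {W : C} (a b c : W ⟶ A), a ≫ f = b ≫ f → b ≫ g = c ≫ g →
      ∃ t : W ⟶ T, t ≫ X = a ∧ t ≫ Y = b ∧ t ≫ Zc = c := by
    intro W a b c hab hbc
    refine ⟨pullback.lift (pullback.lift a b hab) (pullback.lift b c hbc) (by simp), ?_, ?_, ?_⟩
    · simp [X, tf]
    · simp [Y, tf]
    · simp [Zc, tg]
  let u : T ⟶ B' ⨯ B := prod.lift (X ≫ g) (Zc ≫ f)
  let v : A ⟶ B' ⨯ B := prod.lift g f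
  let d1 : pullback u v ⟶ T := pullback.fst u v
  let d2 : pullback u v ⟶ A := pullback.snd u v
  have hd : d1 ≫ u = d2 ≫ v := pullback.condition
  have hd1 : d2 ≫ g = d1 ≫ X ≫ g := by
    have := congrArg (fun t => t ≫ prod.fst) hd
    simpa [u, v] using this.symm
  have hd2 : d2 ≫ f = d1 ≫ Zc ≫ f := by
    have := congrArg (fun t => t ≫ prod.snd) hd
    simpa [u, v] using this.symm
  have liftD : ∀ {W : C} (t : W ⟶ T) (w : W ⟶ A), t ≫ X ≫ g = w ≫ g → t ≫ Zc ≫ f = w ≫ f →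
      ∃ l : W ⟶ pullback u v, l ≫ d1 = t := by
    intro W t w hg hf
    refine ⟨pullback.lift t w ?_, pullback.lift_fst _ _ _⟩
    apply Limits.prod.hom_ext
    · simpa [u, v] using hg
    · simpa [u, v] using hf
  obtain ⟨s, hs1, hs2, hs3⟩ := liftT (pullback.fst g g) (pullback.fst g g) (pullback.snd g g)
    rfl pullback.condition
  have hk : IsSplitShortExact (kernel.ι tg) tg s := by
    refine ⟨isKernelOf_kernel tg, ?_⟩
    apply pullback.hom_ext
    · rw [hYY] at hs2
      simpa [Y'] using hs2
    · simpa [Zc] using hs3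
  have hd1s : StrongEpi d1 := by
    obtain ⟨I, e, m, he, hm, hem⟩ := hH.regEpiMonoFac d1
    have hkY : kernel.ι tg ≫ Y' = 0 := by
      simp only [Y']; rw [← Category.assoc, kernel.condition, zero_comp]
    have hkZ : kernel.ι tg ≫ Zc = 0 := by
      simp only [Zc]; rw [← Category.assoc, kernel.condition, zero_comp]
    obtain ⟨lk, hlk⟩ := liftD (kernel.ι tg) (kernel.ι tg ≫ X) (by simp) (by
      rw [← Category.assoc, hkZ, Category.assoc, hXY, hYY, ← Category.assoc, hkY])
    obtain ⟨ls, hls⟩ := liftD s (pullback.snd g g)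
      (by rw [← Category.assoc, hs1, pullback.condition])
      (by rw [← Category.assoc, hs3])
    haveI : IsIso m := isIso_of_contains hH.protomodular hk m (lk ≫ e) (ls ≫ e)
      (by rw [Category.assoc, hem, hlk]) (by rw [Category.assoc, hem, hls])
    haveI := strongEpi_of_regEpi he
    rw [← hem]
    infer_instance
  obtain ⟨t, ht1, ht2, ht3⟩ := liftT x y z h1 h2
  obtain ⟨Z', e, w, he, hw⟩ := exists_local hH d1 t
  refine ⟨Z', e, w ≫ d2, he, ?_, ?_⟩
  · rw [Category.assoc, hd1, ← Category.assoc, hw, Category.assoc, ← Category.assoc t, ht1]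
  · rw [Category.assoc, hd2, ← Category.assoc, hw, Category.assoc, ← Category.assoc t, ht3]

/-- Pushouts of regular epis along regular epis are regular pushouts. -/
lemma regular_pushout (hC : IsSemiAbelian C) {A B A' B' : C} {f : A ⟶ B} {g : A ⟶ A'}
    {g' : B ⟶ B'} {f' : A' ⟶ B'} [StrongEpi f] [StrongEpi g] (hp : IsPushout f g g' f')
    {Z : C} (b : Z ⟶ B) (a : Z ⟶ A') (h : b ≫ g' = a ≫ f') :
    ∃ (Z' : C) (e : Z' ⟶ Z) (d : Z' ⟶ A), StrongEpi e ∧ d ≫ f = e ≫ b ∧ d ≫ g = e ≫ a := by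
  have hH := hC.homological
  haveI := hH.hasFiniteLimits
  let j : pullback g g ⟶ B ⨯ B :=
    prod.lift (pullback.fst g g ≫ f) (pullback.snd g g ≫ f)
  obtain ⟨S, q, m, hq, hm, hqm⟩ := hH.regEpiMonoFac j
  haveI := strongEpi_of_regEpi hq
  let p₁ : S ⟶ B := m ≫ prod.fst
  let p₂ : S ⟶ B := m ≫ prod.snd
  have hq1 : q ≫ p₁ = pullback.fst g g ≫ f := by
    simp only [p₁]; rw [← Category.assoc, hqm]; simp [j]
  have hq2 : q ≫ p₂ = pullback.snd g g ≫ f := by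
    simp only [p₂]; rw [← Category.assoc, hqm]; simp [j]
  have hjm : ∀ ⦃Z : C⦄ (a b : Z ⟶ S), a ≫ p₁ = b ≫ p₁ → a ≫ p₂ = b ≫ p₂ → a = b := by
    intro Z a b h1 h2
    rw [← cancel_mono m]
    apply Limits.prod.hom_ext
    · simpa [p₁] using h1
    · simpa [p₂] using h2
  have memS : ∀ {W W' : C} (b b' : W ⟶ B) (e : W' ⟶ W) (c c' : W' ⟶ A), StrongEpi e →
      c ≫ g = c' ≫ g → c ≫ f = e ≫ b → c' ≫ f = e ≫ b' →
      ∃ σ : W ⟶ S, σ ≫ p₁ = b ∧ σ ≫ p₂ = b' := by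
    intro W W' b b' e c c' he hcc hc hc'
    have sq : CommSq (pullback.lift c c' hcc ≫ q) e m (prod.lift b b') := by
      constructor
      rw [Category.assoc, hqm]
      apply Limits.prod.hom_ext
      · simp [j, hc]
      · simp [j, hc']
    refine ⟨sq.lift, ?_, ?_⟩
    · simp only [p₁]; rw [← Category.assoc, sq.fac_right]; simp
    · simp only [p₂]; rw [← Category.assoc, sq.fac_right]; simp
  have ofS : ∀ {W : C} (σ : W ⟶ S), ∃ (W' : C) (e : W' ⟶ W) (c c' : W' ⟶ A), StrongEpi e ∧
      c ≫ g = c' ≫ g ∧ c ≫ f = e ≫ σ ≫ p₁ ∧ c' ≫ f = e ≫ σ ≫ p₂ := by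
    intro W σ
    obtain ⟨W', e, r, he, hr⟩ := exists_local hH q σ
    refine ⟨W', e, r ≫ pullback.fst g g, r ≫ pullback.snd g g, he, ?_, ?_, ?_⟩
    · simp [pullback.condition]
    · rw [Category.assoc, ← hq1, ← Category.assoc, hr, Category.assoc]
    · rw [Category.assoc, ← hq2, ← Category.assoc, hr, Category.assoc]
  have hS : IsInternalEquivRel p₁ p₂ := by
    refine ⟨hjm, ?_, ?_, ?_⟩
    · exact memS (𝟙 B) (𝟙 B) f (𝟙 A) (𝟙 A) inferInstance rfl (by simp) (by simp)
    · obtain ⟨W', e, c, c', he, hcc, hc, hc'⟩ := ofS (𝟙 S)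
      exact memS p₂ p₁ e c' c he hcc.symm (by simpa using hc') (by simpa using hc)
    · intro P q₁ q₂ hP
      obtain ⟨W₁, e₁, c, c', he₁, hcc, hc, hc'⟩ := ofS q₁
      obtain ⟨W₂, e₂, d, d', he₂, hdd, hd, hd'⟩ := ofS (e₁ ≫ q₂)
      have h1 : (e₂ ≫ c') ≫ f = d ≫ f := by
        rw [Category.assoc, hc', hd, hP.w, Category.assoc]
      have h0 : (e₂ ≫ c) ≫ g = (e₂ ≫ c') ≫ g := by
        rw [Category.assoc, hcc, Category.assoc]
      obtain ⟨W₃, e₃, w, he₃, hw1, hw2⟩ := perm hH g f (e₂ ≫ c) (e₂ ≫ c') d h0 h1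
      refine memS (q₁ ≫ p₁) (q₂ ≫ p₂) (e₃ ≫ e₂ ≫ e₁) w (e₃ ≫ d') inferInstance ?_ ?_ ?_
      · rw [hw2, hdd, Category.assoc]
      · rw [hw1]; simp [hc]
      · simp [hd']
  obtain ⟨Y, t, ht⟩ := hC.equivRelEffective p₁ p₂ hS
  obtain ⟨h', hh'⟩ := exists_desc hH g (f ≫ t) (by
    intro W a b hab
    have hr : pullback.lift a b hab ≫ q ≫ p₁ ≫ t = pullback.lift a b hab ≫ q ≫ p₂ ≫ t := by
      rw [ht.w]
    rw [← Category.assoc q, hq1, ← Category.assoc q, hq2] at hr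
    simpa using hr)
  obtain ⟨u, hu1, hu2⟩ : ∃ u : B' ⟶ Y, g' ≫ u = t ∧ f' ≫ u = h' :=
    ⟨hp.desc t h' hh'.symm, hp.inl_desc _ _ _, hp.inr_desc _ _ _⟩
  obtain ⟨Z₁, e₁, x, he₁, hx⟩ := exists_local hH f b
  obtain ⟨Z₂, e₂, y, he₂, hy⟩ := exists_local hH g (e₁ ≫ a)
  have hxy : (e₂ ≫ e₁ ≫ b) ≫ t = (y ≫ f) ≫ t := by
    rw [← hu1]
    have : (y ≫ f) ≫ g' = (e₂ ≫ e₁ ≫ b) ≫ g' := by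
      rw [Category.assoc, hp.w, ← Category.assoc, hy]
      simp [h]
    rw [← Category.assoc, ← this, Category.assoc]
  obtain ⟨Z₃, e₃, c, c', he₃, hcc, hc, hc'⟩ := ofS (ht.lift _ _ hxy)
  rw [ht.lift_fst] at hc
  rw [ht.lift_snd] at hc'
  obtain ⟨Z₄, e₄, w, he₄, hw1, hw2⟩ := perm hH f g (e₃ ≫ y) c' c
    (by rw [hc', Category.assoc]) hcc.symm
  refine ⟨Z₄, e₄ ≫ e₃ ≫ e₂ ≫ e₁, w, inferInstance, ?_, ?_⟩
  · rw [hw2, hc]; simp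
  · rw [hw1]; simp [hy]

end Helpers

section Refl

lemma Reflection.ext' {C : Type u} [Category.{v} C] {P : C → Prop} (R : Reflection C P) {X B : C}
    (hB : P B) {g g' : R.F.obj X ⟶ B} (h : R.η.app X ≫ g = R.η.app X ≫ g') : g = g' :=
  (R.univ hB (R.η.app X ≫ g')).unique h rfl

lemma Reflection.nat {C : Type u} [Category.{v} C] {P : C → Prop} (R : Reflection C P) {X Y : C}
    (f : X ⟶ Y) : f ≫ R.η.app Y = R.η.app X ≫ R.F.map f := R.η.naturality f

lemma Reflection.isIso_unit {C : Type u} [Category.{v} C] {P : C → Prop} (R : Reflection C P)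
    {X : C} (r : R.F.obj X ⟶ X) (h : R.η.app X ≫ r = 𝟙 X) : IsIso (R.η.app X) := by
  refine ⟨r, h, ?_⟩
  apply R.ext' (R.mem X)
  rw [← Category.assoc, h]; simp

lemma Reflection.mem_of_retract {C : Type u} [Category.{v} C] {P : C → Prop} (R : Reflection C P)
    (hP : Replete P) {X : C} (r : R.F.obj X ⟶ X) (h : R.η.app X ≫ r = 𝟙 X) : P X := by
  haveI := R.isIso_unit r h
  exact hP (R.mem X) (asIso (R.η.app X)).symm

lemma Reflection.isIso_of_mem {C : Type u} [Category.{v} C] {P : C → Prop} (R : Reflection C P)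
    {X : C} (h : P X) : IsIso (R.η.app X) := by
  obtain ⟨r, hr, -⟩ := R.univ h (𝟙 X)
  exact R.isIso_unit r hr

lemma Reflection.map_zero' {C : Type u} [Category.{v} C] [HasZeroMorphisms C] {P : C → Prop}
    (R : Reflection C P) (X Y : C) : R.F.map (0 : X ⟶ Y) = 0 := by
  apply R.ext' (R.mem Y)
  rw [← R.nat]; simp

lemma Reflection.pb_mem {C : Type u} [Category.{v} C] {P : C → Prop} (R : Reflection C P)
    (hP : Replete P) {W X Y Z : C} {fst : W ⟶ X} {snd : W ⟶ Y} {f : X ⟶ Z} {g : Y ⟶ Z}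
    (h : IsPullback fst snd f g) (hX : P X) (hY : P Y) (hZ : P Z) : P W := by
  obtain ⟨a, ha, -⟩ := R.univ hX fst
  obtain ⟨b, hb, -⟩ := R.univ hY snd
  have hab : a ≫ f = b ≫ g := by
    apply R.ext' hZ
    rw [← Category.assoc, ha, ← Category.assoc, hb, h.w]
  refine R.mem_of_retract hP (h.lift a b hab) ?_
  apply h.hom_ext
  · simp [ha]
  · simp [hb]

/-- The composite reflector inverts the units of the larger reflection. -/
lemma isIso_map_unit {C : Type u} [Category.{v} C] {PB PC : C → Prop} (RI : Reflection C PB)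
    (RC : Reflection C PC) (hsub : ∀ X : C, PC X → PB X) (X : C) :
    IsIso (RC.F.map (RI.η.app X)) := by
  obtain ⟨g, hg, -⟩ := RI.univ (X := X) (hsub _ (RC.mem X)) (RC.η.app X)
  obtain ⟨w, hw, -⟩ := RC.univ (X := RI.F.obj X) (RC.mem X) g
  have h1 := RC.nat (RI.η.app X)
  dsimp at h1 hg hw
  refine ⟨w, ?_, ?_⟩
  · refine RC.ext' (X := X) (RC.mem X) ?_
    dsimp
    rw [← Category.assoc, ← h1, Category.assoc, hw, hg]; simp
  · refine RC.ext' (X := RI.F.obj X) (RC.mem _) ?_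
    refine RI.ext' (X := X) (hsub _ (RC.mem _)) ?_
    dsimp
    rw [← Category.assoc (RC.η.app _), hw, ← Category.assoc, hg, ← h1]; simp

variable {C : Type u} [Category.{v} C] [HasZeroMorphisms C] [HasZeroObject C]

lemma trivial_of_jointlyMono (hC : IsSemiAbelian C) {P : C → Prop} (R : Reflection C P)
    (hB : IsBirkhoff R) {A B : C} (f : A ⟶ B) [StrongEpi f]
    (hm : ∀ ⦃W : C⦄ (a b : W ⟶ A), a ≫ R.η.app A = b ≫ R.η.app A → a ≫ f = b ≫ f → a = b) :
    IsTrivialExt R f := by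
  haveI := strongEpi_of_regEpi (hB.units_regEpi A)
  refine isPullback_mk (R.nat f).symm ?_ hm
  intro W a b hab
  obtain ⟨Z', e, d, he, h1, h2⟩ := regular_pushout hC
    (hB.pushout_units f (regEpi_of_strongEpi hC.homological f)) b a hab.symm
  obtain ⟨l, hl⟩ := exists_desc hC.homological e d (by
    intro V x y hxy
    apply hm
    · rw [Category.assoc, Category.assoc, h2, ← Category.assoc, hxy, Category.assoc]
    · rw [Category.assoc, Category.assoc, h1, ← Category.assoc, hxy, Category.assoc])
  refine ⟨l, ?_, ?_⟩
  · rw [← cancel_epi e, ← Category.assoc, hl, h2]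
  · rw [← cancel_epi e, ← Category.assoc, hl, h1]

/-- Birkhoff subcategories are admissible. -/
lemma birkhoff_adm (hC : IsSemiAbelian C) {P : C → Prop} (R : Reflection C P)
    (hB : IsBirkhoff R) {A Q Pb : C} (hQ : P Q) (q : Q ⟶ R.F.obj A) [StrongEpi q]
    {p1 : Pb ⟶ A} {p2 : Pb ⟶ Q} (h : IsPullback p1 p2 (R.η.app A) q) :
    ∃ ρ : R.F.obj Pb ⟶ Q, IsIso ρ ∧ R.η.app Pb ≫ ρ = p2 := by
  have hH := hC.homological
  obtain ⟨ρ, hρ, -⟩ := R.univ hQ p2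
  refine ⟨ρ, ?_, hρ⟩
  haveI : StrongEpi p1 := strongEpi_pb hH h.flip
  haveI := strongEpi_of_regEpi (hB.units_regEpi A)
  haveI s2 : StrongEpi p2 := strongEpi_pb hH h
  have ht : IsTrivialExt R p1 := by
    apply trivial_of_jointlyMono hC R hB
    intro W a b h1 h2
    apply h.hom_ext h2
    rw [← hρ, ← Category.assoc, h1, Category.assoc]
  haveI : StrongEpi ρ := by
    rw [← hρ] at s2
    exact strongEpi_of_strongEpi (R.η.app Pb) ρ
  have hρq : R.F.map p1 = ρ ≫ q := by
    apply R.ext' (R.mem A)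
    rw [← R.nat, h.w, ← Category.assoc, hρ]
  haveI : Mono ρ := by
    apply mono_of_trivial_kernel hH
    intro Z z hz
    have hw : z ≫ R.F.map p1 = 0 ≫ R.η.app A := by
      rw [hρq, ← Category.assoc, hz]; simp
    have h0 : ht.lift z 0 hw = 0 := by
      apply h.hom_ext
      · rw [ht.lift_snd]; simp
      · rw [← hρ, ← Category.assoc, ht.lift_fst, hz]; simp
    rw [← ht.lift_fst z 0 hw, h0]; simp
  exact isIso_of_mono_of_strongEpi ρ

end Refl

/-- Proposition 6.1. Consider a composite reflection
`A ⇄ B ⇄ C` where `A` is a semi-abelian category, `B` (given by the predicate `PB`)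
is a Birkhoff subcategory of `A` with reflector `RI`, and `C` (given by `PC`) is a
(normal epi)-reflective subcategory of `B` which is admissible with respect to normal
epimorphisms and whose reflector `J` is protoadditive; the composite reflection
`J ∘ I` is encoded by the reflection `RC` of `A` onto `PC`, and the conditions on `J`
are expressed by restricting to objects of `B`. Then the composite reflector is
admissible with respect to normal epimorphisms and, for any normal epimorphism
`f : A ⟶ B`: `f` is a normal extension w.r.t. `RC` iff it is a central extension
w.r.t. `RC` iff (`K[f] ∈ C` and `f` is a normal extension w.r.t. `RI`). -/
theorem statement19 {C : Type u} [Category.{v} C] [HasZeroObject C] [HasZeroMorphisms C]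
    (hC : IsSemiAbelian C)
    {PB PC : C → Prop} (hreplB : Replete PB) (hreplC : Replete PC)
    (RI : Reflection C PB) (hBirk : IsBirkhoff RI)
    (RC : Reflection C PC) (hsub : ∀ X : C, PC X → PB X)
    -- `C` is (normal epi)-reflective in `B`: the units at objects of `B` are normal epis
    (hJne : ∀ X : C, PB X → IsNormalEpiArrow (RC.η.app X))
    -- `J` is admissible with respect to normal epimorphisms
    (hJadm : ∀ ⦃A X Pb : C⦄, PB A → PC X →
      ∀ (x : X ⟶ RC.F.obj A) (p1 : Pb ⟶ A) (p2 : Pb ⟶ X), IsNormalEpiArrow x →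
        IsPullback p1 p2 (RC.η.app A) x →
        IsPullback (RC.F.map p1) (RC.F.map p2) (RC.F.map (RC.η.app A)) (RC.F.map x))
    -- `J` is protoadditive: split short exact sequences in `B` are preserved
    (hJproto : ∀ ⦃K A B : C⦄ (k : K ⟶ A) (f : A ⟶ B) (s : B ⟶ A),
      PB K → PB A → PB B → IsSplitShortExact k f s →
      IsSplitShortExact (RC.F.map k) (RC.F.map f) (RC.F.map s)) :
    AdmissibleN RC ∧
    ∀ ⦃A B : C⦄ (f : A ⟶ B), IsNormalEpiArrow f →
      ((IsNormalExtN RC f ↔ IsCentralExtN RC f) ∧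
        (IsNormalExtN RC f ↔
          ((∃ (K : C) (k : K ⟶ A), IsKernelOf k f ∧ PC K) ∧ IsNormalExtN RI f))) := by
  have hH := hC.homological
  haveI := hH.hasFiniteLimits
  refine ⟨?_, ?_⟩
  · intro A X Pb x p1 p2 hX hx hpb
    haveI i1 := isIso_map_unit RI RC hsub
    haveI i2 := isIso_map_unit RC RC (fun _ h => h)
    let x' : X ⟶ RC.F.obj (RI.F.obj A) := x ≫ RC.F.map (RI.η.app A)
    have hx' : IsNormalEpiArrow x' := hx.comp_iso _
    haveI := strongEpi_of_regEpi hx'.regEpi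
    have hQ := IsPullback.of_hasPullback (RC.η.app (RI.F.obj A)) x'
    have hJ := hJadm (RI.mem A) hX x' _ _ hx' hQ
    haveI : IsIso (RC.F.map (pullback.snd (RC.η.app (RI.F.obj A)) x')) :=
      hJ.isIso_snd_of_isIso
    haveI : StrongEpi (pullback.fst (RC.η.app (RI.F.obj A)) x') := strongEpi_pb hH hQ.flip
    have hQB : PB (pullback (RC.η.app (RI.F.obj A)) x') :=
      RI.pb_mem hreplB hQ (RI.mem A) (hsub _ hX) (hsub _ (RC.mem _))
    have hl : (p1 ≫ RI.η.app A) ≫ RC.η.app (RI.F.obj A) = p2 ≫ x' := by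
      rw [Category.assoc, RC.nat, ← Category.assoc, hpb.w, Category.assoc]
    have hP : IsPullback p1 (hQ.lift _ _ hl) (RI.η.app A)
        (pullback.fst (RC.η.app (RI.F.obj A)) x') := by
      apply isPullback_mk
      · rw [hQ.lift_fst]
      · intro W a b hab
        have hw : a ≫ RC.η.app A = (b ≫ pullback.snd (RC.η.app (RI.F.obj A)) x') ≫ x := by
          rw [← cancel_mono (RC.F.map (RI.η.app A)), Category.assoc, ← RC.nat, ← Category.assoc,
            hab, Category.assoc, hQ.w]
          simp [x']
        refine ⟨hpb.lift a _ hw, hpb.lift_fst _ _ _, ?_⟩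
        apply hQ.hom_ext
        · rw [Category.assoc, hQ.lift_fst, ← Category.assoc, hpb.lift_fst, hab]
        · rw [Category.assoc, hQ.lift_snd, hpb.lift_snd]
      · intro W a b h1 h2
        apply hpb.hom_ext h1
        rw [← hQ.lift_snd _ _ hl, ← Category.assoc, h2, Category.assoc]
    obtain ⟨ρ, hρi, hρ⟩ := birkhoff_adm hC RI hBirk hQB _ hP
    have hp2 : RC.F.map p2 = (RC.F.map (RI.η.app Pb) ≫ RC.F.map ρ) ≫
        RC.F.map (pullback.snd (RC.η.app (RI.F.obj A)) x') := by
      rw [← Functor.map_comp, hρ, ← Functor.map_comp, hQ.lift_snd]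
    haveI : IsIso (RC.F.map p2) := by
      rw [hp2]; infer_instance
    refine IsPullback.of_vert_isIso ⟨?_⟩
    rw [← Functor.map_comp, hpb.w, Functor.map_comp]
  intro A B f hf
  have h12 : IsNormalExtN RC f → IsCentralExtN RC f := by
    rintro ⟨_, Pb, p1, p2, hpb, ht⟩
    exact ⟨hf, A, f, hf, Pb, p1, p2, hpb, ht⟩
  haveI sf : StrongEpi f := strongEpi_of_regEpi hf.regEpi
  have h23 : IsCentralExtN RC f →
      ((∃ (K : C) (k : K ⟶ A), IsKernelOf k f ∧ PC K) ∧ IsNormalExtN RI f) := by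
    rintro ⟨_, E, p, hp, Pb, p1, p2, hpb, ht⟩
    haveI := strongEpi_of_regEpi hp.regEpi
    haveI : StrongEpi p1 := strongEpi_pb hH hpb.flip
    haveI : StrongEpi p2 := strongEpi_pb hH hpb
    refine ⟨⟨kernel f, kernel.ι f, isKernelOf_kernel f, ?_⟩, hf, ?_⟩
    · have hk0 : (0 : kernel f ⟶ E) ≫ p = kernel.ι f ≫ f := by simp
      obtain ⟨kh, hk1, hk2⟩ : ∃ kh : kernel f ⟶ Pb, kh ≫ p1 = 0 ∧ kh ≫ p2 = kernel.ι f :=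
        ⟨hpb.lift _ _ hk0, hpb.lift_fst _ _ _, hpb.lift_snd _ _ _⟩
      have hw : RC.F.map kh ≫ RC.F.map p1 = 0 ≫ RC.η.app E := by
        rw [← Functor.map_comp, hk1, RC.map_zero']; simp
      obtain ⟨l, hl1, hl2⟩ : ∃ l : RC.F.obj (kernel f) ⟶ Pb, l ≫ RC.η.app Pb = RC.F.map kh ∧
          l ≫ p1 = 0 := ⟨ht.lift _ _ hw, ht.lift_fst _ _ _, ht.lift_snd _ _ _⟩
      refine RC.mem_of_retract hreplC (kernel.lift f (l ≫ p2) ?_) ?_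
      · rw [Category.assoc, ← hpb.w, ← Category.assoc, hl2, zero_comp]
      · have : RC.η.app (kernel f) ≫ l = kh := by
          apply ht.hom_ext
          · rw [Category.assoc, hl1]; exact (RC.nat kh).symm
          · rw [Category.assoc, hl2, hk1, comp_zero]
        refine (cancel_mono (kernel.ι f)).1 ?_
        refine Eq.trans (Category.assoc _ _ _) ?_
        refine Eq.trans ?_ (Category.id_comp (kernel.ι f)).symm
        rw [kernel.lift_ι, ← Category.assoc, this, hk2]
    · -- joint monicity with respect to `RI` on `p1`
      have hj : ∀ ⦃W : C⦄ (a b : W ⟶ Pb), a ≫ RI.η.app Pb = b ≫ RI.η.app Pb →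
          a ≫ p1 = b ≫ p1 → a = b := by
        intro W a b h1 h2
        apply ht.hom_ext _ h2
        obtain ⟨g, hg, -⟩ := RI.univ (X := Pb) (hsub _ (RC.mem Pb)) (RC.η.app Pb)
        rw [← hg, ← Category.assoc, h1, Category.assoc]
      have hR := IsPullback.of_hasPullback f f
      refine ⟨pullback f f, pullback.fst f f, pullback.snd f f, hR, ?_⟩
      have hR' := IsPullback.of_hasPullback p2 (pullback.fst f f)
      set R' := pullback p2 (pullback.fst f f)
      set r1 : R' ⟶ Pb := pullback.fst p2 (pullback.fst f f)
      set r2 : R' ⟶ pullback f f := pullback.snd p2 (pullback.fst f f)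
      haveI : StrongEpi r2 := strongEpi_pb hH hR'
      haveI : StrongEpi (pullback.fst f f) := strongEpi_pb hH hR.flip
      have hh : (r1 ≫ p1) ≫ p = (r2 ≫ pullback.snd f f) ≫ f := by
        rw [Category.assoc, hpb.w, ← Category.assoc, hR'.w, Category.assoc, hR.w, Category.assoc]
      obtain ⟨t, ht1, ht2⟩ : ∃ t : R' ⟶ Pb, t ≫ p1 = r1 ≫ p1 ∧
          t ≫ p2 = r2 ≫ pullback.snd f f :=
        ⟨hpb.lift _ _ hh, hpb.lift_fst _ _ _, hpb.lift_snd _ _ _⟩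
      have hj' : ∀ ⦃W : C⦄ (a b : W ⟶ R'), a ≫ RI.η.app R' = b ≫ RI.η.app R' →
          a ≫ r1 = b ≫ r1 → a = b := by
        intro W a b h1 h2
        have h3 : a ≫ t = b ≫ t := by
          apply hj
          · rw [Category.assoc, RI.nat, ← Category.assoc, h1, Category.assoc, ← RI.nat,
              Category.assoc]
          · rw [Category.assoc, ht1, ← Category.assoc, h2, Category.assoc, Category.assoc, ht1]
        apply hR'.hom_ext h2
        apply hR.hom_ext
        · rw [Category.assoc, ← hR'.w, ← Category.assoc, h2, Category.assoc, Category.assoc, hR'.w]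
        · rw [Category.assoc, ← ht2, ← Category.assoc, h3, Category.assoc, Category.assoc, ht2]
      let s : A ⟶ pullback f f := pullback.lift (𝟙 A) (𝟙 A) rfl
      have hs1 : s ≫ pullback.fst f f = 𝟙 A := pullback.lift_fst _ _ _
      have hsw : 𝟙 Pb ≫ p2 = (p2 ≫ s) ≫ pullback.fst f f := by simp [hs1]
      obtain ⟨s', hs'1, hs'2⟩ : ∃ s' : Pb ⟶ R', s' ≫ r1 = 𝟙 Pb ∧ s' ≫ r2 = p2 ≫ s :=
        ⟨hR'.lift _ _ hsw, hR'.lift_fst _ _ _, hR'.lift_snd _ _ _⟩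
      haveI := strongEpi_of_regEpi (hBirk.units_regEpi R')
      have hker : ∀ ⦃Z : C⦄ (c : Z ⟶ pullback f f), c ≫ pullback.fst f f = 0 →
          c ≫ RI.η.app (pullback f f) = 0 → c = 0 := by
        intro Z c hc1 hc2
        obtain ⟨Z', e, d, he, hd1, hd2⟩ := regular_pushout hC
          (hBirk.pushout_units r2 (regEpi_of_strongEpi hH r2)) c 0 (by rw [hc2, zero_comp])
        rw [comp_zero] at hd2
        have hd : d = d ≫ r1 ≫ s' := by
          apply hj'
          · rw [hd2, Category.assoc, RI.nat, ← Category.assoc, hd2, zero_comp]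
          · simp [hs'1]
        rw [← cancel_epi e, ← hd1, hd, Category.assoc, Category.assoc, hs'2, ← Category.assoc r1,
          hR'.w, ← Category.assoc, ← Category.assoc d, hd1, Category.assoc, Category.assoc,
          ← Category.assoc c, hc1]
        simp
      apply trivial_of_jointlyMono hC RI hBirk
      have hmono : Mono (prod.lift (RI.η.app (pullback f f)) (pullback.fst f f)) := by
        apply mono_of_trivial_kernel hH
        intro Z z hz
        apply hker
        · have := congrArg (fun t => t ≫ prod.snd) hz
          simpa [prod.lift_fst, prod.lift_snd] using this
        · have := congrArg (fun t => t ≫ prod.fst) hz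
          simpa [prod.lift_fst, prod.lift_snd] using this
      intro W a b h1 h2
      rw [← cancel_mono (prod.lift (RI.η.app (pullback f f)) (pullback.fst f f))]
      apply Limits.prod.hom_ext
      · simpa [prod.lift_fst] using h1
      · simpa [prod.lift_snd] using h2
  have h31 : ((∃ (K : C) (k : K ⟶ A), IsKernelOf k f ∧ PC K) ∧ IsNormalExtN RI f) →
      IsNormalExtN RC f := by
    rintro ⟨⟨K, k, hk, hK⟩, _, Pb, p1, p2, hpb, ht⟩
    refine ⟨hf, Pb, p1, p2, hpb, ?_⟩
    have hk0 : (0 : K ⟶ A) ≫ f = k ≫ f := by rw [hk.w, zero_comp]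
    obtain ⟨kh, hk1, hk2⟩ : ∃ kh : K ⟶ Pb, kh ≫ p1 = 0 ∧ kh ≫ p2 = k :=
      ⟨hpb.lift _ _ hk0, hpb.lift_fst _ _ _, hpb.lift_snd _ _ _⟩
    obtain ⟨s, hs1⟩ : ∃ s : A ⟶ Pb, s ≫ p1 = 𝟙 A :=
      ⟨hpb.lift (𝟙 A) (𝟙 A) rfl, hpb.lift_fst _ _ _⟩
    let κ : K ⟶ RI.F.obj Pb := kh ≫ RI.η.app Pb
    have hκ : κ ≫ RI.F.map p1 = 0 := by
      simp only [κ]; rw [Category.assoc, ← RI.nat, ← Category.assoc, hk1, zero_comp]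
    have hses : IsSplitShortExact κ (RI.F.map p1) (RI.F.map s) := by
      refine ⟨isKernelOf_mk hκ ?_ ?_, ?_⟩
      · intro W a b hab
        apply hk.hom_ext
        rw [← hk2, ← Category.assoc, ← Category.assoc]
        congr 1
        apply ht.hom_ext
        · simpa [κ] using hab
        · rw [Category.assoc, hk1, Category.assoc, hk1]; simp
      · intro W z hz
        have hz' : z ≫ RI.F.map p1 = 0 ≫ RI.η.app A := by rw [hz, zero_comp]
        obtain ⟨w, hw1, hw2⟩ : ∃ w : W ⟶ Pb, w ≫ RI.η.app Pb = z ∧ w ≫ p1 = 0 :=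
          ⟨ht.lift _ _ hz', ht.lift_fst _ _ _, ht.lift_snd _ _ _⟩
        obtain ⟨r, hr⟩ := hk.exists_lift (w ≫ p2) (by
          rw [Category.assoc, ← hpb.w, ← Category.assoc, hw2, zero_comp])
        refine ⟨r, ?_⟩
        have : r ≫ kh = w := by
          apply hpb.hom_ext
          · rw [Category.assoc, hk1, hw2, comp_zero]
          · rw [Category.assoc, hk2, hr]
        simp only [κ]
        rw [← Category.assoc, this, hw1]
      · rw [← Functor.map_comp, hs1, CategoryTheory.Functor.map_id]
    have hG := hJproto κ (RI.F.map p1) (RI.F.map s) (hsub _ hK) (RI.mem _) (RI.mem _) hses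
    haveI := RC.isIso_of_mem hK
    have hQ := IsPullback.of_hasPullback (RC.F.map (RI.F.map p1)) (RC.η.app (RI.F.obj A))
    set Q := pullback (RC.F.map (RI.F.map p1)) (RC.η.app (RI.F.obj A))
    set q1 := pullback.fst (RC.F.map (RI.F.map p1)) (RC.η.app (RI.F.obj A))
    set q2 := pullback.snd (RC.F.map (RI.F.map p1)) (RC.η.app (RI.F.obj A))
    obtain ⟨α, hα1, hα2⟩ : ∃ α : RI.F.obj Pb ⟶ Q, α ≫ q1 = RC.η.app (RI.F.obj Pb) ∧
        α ≫ q2 = RI.F.map p1 :=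
      ⟨hQ.lift _ _ (RC.nat (RI.F.map p1)).symm, hQ.lift_fst _ _ _, hQ.lift_snd _ _ _⟩
    have hκα1 : (κ ≫ α) ≫ q1 = RC.η.app K ≫ RC.F.map κ := by
      rw [Category.assoc, hα1, RC.nat]
    have hκα2 : (κ ≫ α) ≫ q2 = 0 := by rw [Category.assoc, hα2, hκ]
    have hses' : IsSplitShortExact (κ ≫ α) q2 (RI.F.map s ≫ α) := by
      refine ⟨isKernelOf_mk hκα2 ?_ ?_, ?_⟩
      · intro W a b hab
        have h1 : (a ≫ RC.η.app K) ≫ RC.F.map κ = (b ≫ RC.η.app K) ≫ RC.F.map κ := by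
          have e : ∀ c : W ⟶ K, (c ≫ RC.η.app K) ≫ RC.F.map κ = (c ≫ κ ≫ α) ≫ q1 := fun c => by
            rw [Category.assoc, ← hκα1]; simp only [Category.assoc]
          rw [e, e, hab]
        exact (cancel_mono (RC.η.app K)).1 (hG.isKernel.hom_ext _ _ h1)
      · intro W z hz
        obtain ⟨r, hr⟩ := hG.isKernel.exists_lift (z ≫ q1) (by
          rw [Category.assoc, hQ.w, ← Category.assoc, hz, zero_comp])
        refine ⟨r ≫ inv (RC.η.app K), ?_⟩
        apply hQ.hom_ext
        · rw [Category.assoc, hκα1, ← hr]; simp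
        · rw [Category.assoc, hκα2, hz, comp_zero]
      · rw [Category.assoc, hα2, hses.split]; rfl
    haveI : IsIso α := hH.protomodular κ (RI.F.map p1) (RI.F.map s) (κ ≫ α) q2 (RI.F.map s ≫ α)
      (𝟙 K) α (𝟙 _) hses hses' (by simp) (by rw [hα2]; simp) (by simp) inferInstance inferInstance
    have hpb2 : IsPullback (RC.η.app (RI.F.obj Pb)) (RI.F.map p1) (RC.F.map (RI.F.map p1))
        (RC.η.app (RI.F.obj A)) :=
      IsPullback.of_iso_pullback ⟨(RC.nat (RI.F.map p1)).symm⟩ (asIso α) hα1 hα2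
    have hbig := IsPullback.paste_horiz ht hpb2
    rw [RC.nat (RI.η.app Pb), RC.nat (RI.η.app A)] at hbig
    haveI i1 := isIso_map_unit RI RC hsub
    have hright : IsPullback (RC.F.map (RI.η.app Pb)) (RC.F.map p1) (RC.F.map (RI.F.map p1))
        (RC.F.map (RI.η.app A)) := by
      refine IsPullback.of_horiz_isIso ⟨?_⟩
      rw [← Functor.map_comp, ← RI.nat, Functor.map_comp]
    exact IsPullback.of_right hbig (RC.nat p1).symm hright
  exact ⟨⟨h12, fun h => h31 (h23 h)⟩, ⟨fun h => h23 (h12 h), h31⟩⟩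

end ProtoPaper
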